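/- The map ε ↦ ĝ_ε(X;Y) is concave on [0,∞): for all 0 ≤ ε₁ < ε₂ < ε₃, ĝ_{ε₂}(X;Y) ≥ ((ε₂−ε₁)/(ε₃−ε₁))·ĝ_{ε₃}(X;Y) + ((ε₃−ε₂)/(ε₃−ε₁))·ĝ_{ε₁}(X;Y). -/

import Mathlib

open scoped BigOperators

noncomputable section

namespace RatePrivacy

variable {α β γ : Type*}

/-- `p` is a probability mass function on a finite alphabet. -/
def IsPMF [Fintype α] (p : α → ℝ) : Prop := (∀ a, 0 ≤ p a) ∧ ∑ a, p a = 1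

/-- Shannon entropy (in bits) of the distribution `p`. -/
def ent [Fintype α] (p : α → ℝ) : ℝ := ∑ a, -(p a * Real.logb 2 (p a))

/-- First marginal of a joint distribution. -/
def margA [Fintype α] [Fintype β] (p : α × β → ℝ) : α → ℝ := fun a => ∑ b, p (a, b)

/-- Second marginal of a joint distribution. -/
def margB [Fintype α] [Fintype β] (p : α × β → ℝ) : β → ℝ := fun b => ∑ a, p (a, b)

/-- Mutual information (in bits) of a joint distribution `p`:
`I(A;B) = H(A) + H(B) - H(A,B)`. -/
def mi [Fintype α] [Fintype β] (p : α × β → ℝ) : ℝ :=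
  ent (margA p) + ent (margB p) - ent p

/-- `q` is a (row-stochastic) channel. -/
def IsChannel [Fintype γ] (q : β → γ → ℝ) : Prop :=
  (∀ y z, 0 ≤ q y z) ∧ ∀ y, ∑ z, q y z = 1

/-- Joint distribution of `(X, Z)` when `Z` is obtained from `Y` through the channel `q`
(so that `X — Y — Z` is a Markov chain). -/
def jointXZ [Fintype α] [Fintype β] [Fintype γ] (p : α × β → ℝ) (q : β → γ → ℝ) :
    α × γ → ℝ := fun xz => ∑ y, p (xz.1, y) * q y xz.2

/-- Joint distribution of `(Y, Z)` when `Z` is obtained from `Y` through the channel `q`. -/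
def jointYZ [Fintype α] [Fintype β] [Fintype γ] (p : α × β → ℝ) (q : β → γ → ℝ) :
    β × γ → ℝ := fun yz => margB p yz.1 * q yz.1 yz.2

/-- Achievable rates `I(Y;Z)` over all privacy filters `Z` (on finite alphabets, wlog `Fin n`)
with `X — Y — Z` Markov and `I(X;Z) ≤ ε`. -/
def gSet [Fintype α] [Fintype β] (p : α × β → ℝ) (ε : ℝ) : Set ℝ :=
  { r | ∃ (n : ℕ) (q : β → Fin n → ℝ), IsChannel q ∧
        mi (jointXZ p q) ≤ ε ∧ r = mi (jointYZ p q) }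

/-- The rate-privacy function `g_ε(X;Y)` (privacy measured by mutual information). -/
def g [Fintype α] [Fintype β] (p : α × β → ℝ) (ε : ℝ) : ℝ := sSup (gSet p ε)

/-- Values `E[f(A) g(B)]` over all zero-mean unit-variance `f, g`, used to define
the Hirschfeld–Gebelein–Rényi maximal correlation. -/
def corrSet [Fintype α] [Fintype β] (p : α × β → ℝ) : Set ℝ :=
  { r | ∃ (f : α → ℝ) (g : β → ℝ),
      (∑ a, margA p a * f a = 0) ∧ (∑ b, margB p b * g b = 0) ∧
      (∑ a, margA p a * (f a) ^ 2 = 1) ∧ (∑ b, margB p b * (g b) ^ 2 = 1) ∧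
      r = ∑ x : α × β, p x * (f x.1 * g x.2) }

/-- Maximal correlation `ρ_m(A;B)` (equal to `0` when the constraint set is empty,
since `sSup ∅ = 0` in `ℝ`). -/
def rhoM [Fintype α] [Fintype β] (p : α × β → ℝ) : ℝ := sSup (corrSet p)

/-- Achievable rates with maximal-correlation privacy constraint `ρ_m²(X;Z) ≤ ε`. -/
def ghSet [Fintype α] [Fintype β] (p : α × β → ℝ) (ε : ℝ) : Set ℝ :=
  { r | ∃ (n : ℕ) (q : β → Fin n → ℝ), IsChannel q ∧
        (rhoM (jointXZ p q)) ^ 2 ≤ ε ∧ r = mi (jointYZ p q) }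

/-- The rate-privacy function `ĝ_ε(X;Y)` (privacy measured by squared maximal correlation). -/
def gh [Fintype α] [Fintype β] (p : α × β → ℝ) (ε : ℝ) : ℝ := sSup (ghSet p ε)

/-- The Kullback–Leibler divergence (in bits) `D(P_{X|Y}(·|y) ‖ P_X)`. -/
def Dxy [Fintype α] [Fintype β] (p : α × β → ℝ) (y : β) : ℝ :=
  ∑ x, (p (x, y) / margB p y) * Real.logb 2 ((p (x, y) / margB p y) / margA p x)

section Marginals

variable [Fintype α] [Fintype β]

lemma sum_margA_mul (P : α × β → ℝ) (f : α → ℝ) :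
    ∑ a, margA P a * f a = ∑ x, P x * f x.1 := by
  simp only [margA, Finset.sum_mul, Fintype.sum_prod_type]

lemma sum_margB_mul (P : α × β → ℝ) (f : β → ℝ) :
    ∑ b, margB P b * f b = ∑ x, P x * f x.2 := by
  simp only [margB, Finset.sum_mul, Fintype.sum_prod_type_right]

lemma IsPMF.margA {P : α × β → ℝ} (hP : IsPMF P) : IsPMF (margA P) := by
  refine ⟨fun a => Finset.sum_nonneg fun b _ => hP.1 _, ?_⟩
  simpa [hP.2] using sum_margA_mul P 1

lemma IsPMF.margB {P : α × β → ℝ} (hP : IsPMF P) : IsPMF (margB P) := by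
  refine ⟨fun a => Finset.sum_nonneg fun b _ => hP.1 _, ?_⟩
  simpa [hP.2] using sum_margB_mul P 1

/-- The joint entropy dominates the entropy of the second marginal. -/
lemma ent_margB_le {P : α × β → ℝ} (hP : IsPMF P) : ent (RatePrivacy.margB P) ≤ ent P := by
  have h := sum_margB_mul P fun b => -Real.logb 2 (RatePrivacy.margB P b)
  simp only [mul_neg] at h
  rw [ent, h, ent]
  refine Finset.sum_le_sum fun x _ => neg_le_neg ?_
  rcases (hP.1 x).eq_or_lt with h0 | h0
  · simp [← h0]
  · have hle : P x ≤ RatePrivacy.margB P x.2 :=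
      Finset.single_le_sum (f := fun a => P (a, x.2)) (fun a _ => hP.1 _) (Finset.mem_univ x.1)
    exact mul_le_mul_of_nonneg_left (Real.logb_le_logb_of_le (by norm_num) h0 hle) h0.le

lemma mi_le_ent_margA {P : α × β → ℝ} (hP : IsPMF P) : mi P ≤ ent (RatePrivacy.margA P) := by
  have := ent_margB_le hP
  unfold mi
  linarith

end Marginals

section MaximalCorrelation

variable [Fintype α] [Fintype β]

/-- Cauchy–Schwarz for the expectation of a product. -/
lemma sq_sum_mul_le {P : α × β → ℝ} (hP : IsPMF P) (f : α → ℝ) (h : β → ℝ) :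
    (∑ x, P x * (f x.1 * h x.2)) ^ 2 ≤
      (∑ a, margA P a * f a ^ 2) * ∑ b, margB P b * h b ^ 2 := by
  rw [sum_margA_mul P fun a => f a ^ 2, sum_margB_mul P fun b => h b ^ 2]
  refine Finset.sum_sq_le_sum_mul_sum_of_sq_le_mul _ (fun x _ => ?_) (fun x _ => ?_)
    fun x _ => le_of_eq (by ring)
  · exact mul_nonneg (hP.1 x) (sq_nonneg _)
  · exact mul_nonneg (hP.1 x) (sq_nonneg _)

lemma bddAbove_corrSet {P : α × β → ℝ} (hP : IsPMF P) : BddAbove (corrSet P) := by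
  refine ⟨1, ?_⟩
  rintro r ⟨f, g, -, -, hf, hg, rfl⟩
  have := sq_sum_mul_le hP f g
  rw [hf, hg, one_mul] at this
  exact (sq_le_one_iff_abs_le_one _).mp this |> abs_le.mp |>.2

lemma neg_mem_corrSet {P : α × β → ℝ} {r : ℝ} (hr : r ∈ corrSet P) : -r ∈ corrSet P := by
  obtain ⟨f, g, h1, h2, h3, h4, rfl⟩ := hr
  refine ⟨fun a => -f a, g, ?_, h2, ?_, h4, ?_⟩
  · simp [h1]
  · simpa using h3
  · simp

lemma sq_le_rhoM_sq {P : α × β → ℝ} (hP : IsPMF P) {r : ℝ} (hr : r ∈ corrSet P) :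
    r ^ 2 ≤ rhoM P ^ 2 :=
  sq_le_sq' (neg_le.mp (le_csSup (bddAbove_corrSet hP) (neg_mem_corrSet hr)))
    (le_csSup (bddAbove_corrSet hP) hr)

lemma rhoM_sq_le {P : α × β → ℝ} {ε : ℝ} (hε : 0 ≤ ε) (h : ∀ r ∈ corrSet P, r ^ 2 ≤ ε) :
    rhoM P ^ 2 ≤ ε := by
  refine Real.sq_le hε |>.mpr ⟨?_, Real.sSup_le (fun r hr => Real.le_sqrt_of_sq_le (h r hr))
    (Real.sqrt_nonneg _)⟩
  refine (neg_nonpos.mpr (Real.sqrt_nonneg _)).trans ?_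
  rcases (corrSet P).eq_empty_or_nonempty with h0 | ⟨r, hr⟩
  · rw [rhoM, h0, Real.sSup_empty]
  · refine Real.sSup_nonneg' ?_
    rcases le_total 0 r with h0 | h0
    · exact ⟨r, hr, h0⟩
    · exact ⟨-r, neg_mem_corrSet hr, neg_nonneg.mpr h0⟩

/-- The maximal correlation bounds `E[f h]` even when `h` is not centred. -/
lemma sq_sum_mul_le_rhoM_sq {P : α × β → ℝ} (hP : IsPMF P) {f : α → ℝ} (h : β → ℝ)
    (hf : ∑ a, margA P a * f a = 0) (hf' : ∑ a, margA P a * f a ^ 2 = 1) :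
    (∑ x, P x * (f x.1 * h x.2)) ^ 2 ≤ rhoM P ^ 2 * ∑ b, margB P b * h b ^ 2 := by
  set m := ∑ b, margB P b * h b with hm
  set v := ∑ b, margB P b * (h b - m) ^ 2 with hv
  have hmean : ∑ b, margB P b * (h b - m) = 0 := by
    simp only [mul_sub, Finset.sum_sub_distrib, ← Finset.sum_mul, hP.margB.2, ← hm]
    ring
  have hvar : v = ∑ b, margB P b * h b ^ 2 - m ^ 2 := by
    have : ∀ b, margB P b * (h b - m) ^ 2 =
        margB P b * h b ^ 2 - margB P b * h b * (2 * m) + margB P b * m ^ 2 := fun b => by ring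
    simp only [hv, this, Finset.sum_add_distrib, Finset.sum_sub_distrib, ← Finset.sum_mul,
      hP.margB.2, ← hm]
    ring
  have hcov : ∑ x, P x * (f x.1 * h x.2) = ∑ x, P x * (f x.1 * (h x.2 - m)) := by
    have : ∀ x : α × β, P x * (f x.1 * (h x.2 - m)) =
        P x * (f x.1 * h x.2) - P x * f x.1 * m := fun x => by ring
    simp only [this, Finset.sum_sub_distrib, ← Finset.sum_mul, ← sum_margA_mul P f, hf]
    ring
  have hv0 : 0 ≤ v := Finset.sum_nonneg fun b _ => mul_nonneg (hP.margB.1 b) (sq_nonneg _)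
  suffices (∑ x, P x * (f x.1 * (h x.2 - m))) ^ 2 ≤ rhoM P ^ 2 * v by
    rw [hcov]
    refine this.trans (mul_le_mul_of_nonneg_left ?_ (sq_nonneg _))
    rw [hvar]
    linarith [sq_nonneg m]
  rcases hv0.eq_or_lt with h0 | h0
  · have := sq_sum_mul_le hP f fun b => h b - m
    rw [← h0, mul_zero]
    rwa [← hv, ← h0, mul_zero] at this
  · have hs : Real.sqrt v ^ 2 = v := Real.sq_sqrt hv0
    have hmem : (∑ x, P x * (f x.1 * (h x.2 - m))) / Real.sqrt v ∈ corrSet P := by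
      refine ⟨f, fun b => (h b - m) / Real.sqrt v, hf, ?_, hf', ?_, ?_⟩
      · simp only [← mul_div_assoc, ← Finset.sum_div, hmean, zero_div]
      · simp only [div_pow, hs, ← mul_div_assoc, ← Finset.sum_div]
        exact div_self h0.ne'
      · simp only [← mul_div_assoc, ← Finset.sum_div]
    have := sq_le_rhoM_sq hP hmem
    rwa [div_pow, hs, div_le_iff₀ h0] at this

end MaximalCorrelation

section Mixture

variable {m n : ℕ}

/-- The joint law of `(A, B)` where `B` ranges over the disjoint union of the alphabets of two
observations, the first being used with weight `c` and the second with weight `d`. -/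
def mix (c d : ℝ) (P : α × Fin m → ℝ) (Q : α × Fin n → ℝ) : α × Fin (m + n) → ℝ := fun x =>
  Fin.append (fun i => c * P (x.1, i)) (fun i => d * Q (x.1, i)) x.2

@[simp] lemma mix_castAdd (c d : ℝ) (P : α × Fin m → ℝ) (Q : α × Fin n → ℝ) (a : α) (i : Fin m) :
    mix c d P Q (a, Fin.castAdd n i) = c * P (a, i) := by simp [mix]

@[simp] lemma mix_natAdd (c d : ℝ) (P : α × Fin m → ℝ) (Q : α × Fin n → ℝ) (a : α) (i : Fin n) :
    mix c d P Q (a, Fin.natAdd m i) = d * Q (a, i) := by simp [mix]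

variable {c d : ℝ} {P : α × Fin m → ℝ} {Q : α × Fin n → ℝ}

variable [Fintype α]

lemma sum_mix_mul (c d : ℝ) (P : α × Fin m → ℝ) (Q : α × Fin n → ℝ)
    (F : α × Fin (m + n) → ℝ) :
    ∑ x, mix c d P Q x * F x =
      c * ∑ x, P x * F (x.1, Fin.castAdd n x.2) + d * ∑ x, Q x * F (x.1, Fin.natAdd m x.2) := by
  simp only [Fintype.sum_prod_type, Fin.sum_univ_add, mix_castAdd, mix_natAdd,
    Finset.sum_add_distrib, Finset.mul_sum, mul_assoc]

lemma margA_mix (a : α) : margA (mix c d P Q) a = c * margA P a + d * margA Q a := by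
  simp [margA, Fin.sum_univ_add, Finset.mul_sum]

@[simp] lemma margB_mix_castAdd (i : Fin m) :
    margB (mix c d P Q) (Fin.castAdd n i) = c * margB P i := by
  simp [margB, Finset.mul_sum]

@[simp] lemma margB_mix_natAdd (i : Fin n) :
    margB (mix c d P Q) (Fin.natAdd m i) = d * margB Q i := by
  simp [margB, Finset.mul_sum]

lemma margA_mix_of_eq (hcd : c + d = 1) (h : margA P = margA Q) :
    margA (mix c d P Q) = margA Q := by
  ext a
  rw [margA_mix, h, ← add_mul, hcd, one_mul]

lemma ent_const_mul {p : α → ℝ} (hp : ∑ a, p a = 1) (hc : c ≠ 0) :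
    ∑ a, -(c * p a * Real.logb 2 (c * p a)) = c * ent p - c * Real.logb 2 c := by
  have : ∀ a, -(c * p a * Real.logb 2 (c * p a)) =
      c * -(p a * Real.logb 2 (p a)) - p a * (c * Real.logb 2 c) := fun a => by
    rcases eq_or_ne (p a) 0 with h | h
    · simp [h]
    · rw [Real.logb_mul hc h]
      ring
  simp only [this, Finset.sum_sub_distrib, ← Finset.mul_sum, ← Finset.sum_mul, hp, one_mul, ent]

lemma ent_mix (hP : IsPMF P) (hQ : IsPMF Q) (hc : c ≠ 0) (hd : d ≠ 0) :
    ent (mix c d P Q) = c * ent P + d * ent Q - (c * Real.logb 2 c + d * Real.logb 2 d) := by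
  have h1 := ent_const_mul hP.2 hc
  have h2 := ent_const_mul hQ.2 hd
  rw [Fintype.sum_prod_type] at h1 h2
  rw [ent, Fintype.sum_prod_type]
  simp only [Fin.sum_univ_add, mix_castAdd, mix_natAdd, Finset.sum_add_distrib]
  rw [h1, h2]
  ring

lemma ent_margB_mix (hP : IsPMF P) (hQ : IsPMF Q) (hc : c ≠ 0) (hd : d ≠ 0) :
    ent (margB (mix c d P Q)) =
      c * ent (margB P) + d * ent (margB Q) - (c * Real.logb 2 c + d * Real.logb 2 d) := by
  have h1 := ent_const_mul hP.margB.2 hc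
  have h2 := ent_const_mul hQ.margB.2 hd
  rw [ent]
  simp only [Fin.sum_univ_add, margB_mix_castAdd, margB_mix_natAdd]
  rw [h1, h2]
  ring

lemma mi_mix (hP : IsPMF P) (hQ : IsPMF Q) (hc : c ≠ 0) (hd : d ≠ 0) (hcd : c + d = 1)
    (h : margA P = margA Q) : mi (mix c d P Q) = c * mi P + d * mi Q := by
  simp only [mi]
  rw [margA_mix_of_eq hcd h, h, ent_mix hP hQ hc hd, ent_margB_mix hP hQ hc hd]
  linear_combination (-ent (margA Q)) * hcd

/-- The squared maximal correlation of a mixture is at most the mixture of the squares. -/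
lemma rhoM_mix_sq_le (hP : IsPMF P) (hQ : IsPMF Q) (hc : 0 ≤ c) (hd : 0 ≤ d) (hcd : c + d = 1)
    (h : margA P = margA Q) :
    rhoM (mix c d P Q) ^ 2 ≤ c * rhoM P ^ 2 + d * rhoM Q ^ 2 := by
  refine rhoM_sq_le (by positivity) ?_
  rintro r ⟨f, g, hf, -, hf', hg', rfl⟩
  rw [margA_mix_of_eq hcd h] at hf hf'
  have hP' := sq_sum_mul_le_rhoM_sq hP (fun i => g (Fin.castAdd n i)) (by rwa [h]) (by rwa [h])
  have hQ' := sq_sum_mul_le_rhoM_sq hQ (fun i => g (Fin.natAdd m i)) hf hf'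
  simp only [Fin.sum_univ_add, margB_mix_castAdd, margB_mix_natAdd, mul_assoc,
    ← Finset.mul_sum] at hg'
  rw [sum_mix_mul c d P Q fun x => f x.1 * g x.2]
  dsimp only
  set u := ∑ x, P x * (f x.1 * g (Fin.castAdd n x.2))
  set w := ∑ x, Q x * (f x.1 * g (Fin.natAdd m x.2))
  set s := ∑ i, margB P i * g (Fin.castAdd n i) ^ 2 with hs
  set t := ∑ i, margB Q i * g (Fin.natAdd m i) ^ 2 with ht
  have hs0 : 0 ≤ s := Finset.sum_nonneg fun i _ => mul_nonneg (hP.margB.1 i) (sq_nonneg _)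
  have ht0 : 0 ≤ t := Finset.sum_nonneg fun i _ => mul_nonneg (hQ.margB.1 i) (sq_nonneg _)
  have hu : |u| ≤ |rhoM P| * √s := by
    rw [← Real.sqrt_sq_eq_abs, ← Real.sqrt_sq_eq_abs, ← Real.sqrt_mul (sq_nonneg _)]
    exact Real.sqrt_le_sqrt hP'
  have hw : |w| ≤ |rhoM Q| * √t := by
    rw [← Real.sqrt_sq_eq_abs, ← Real.sqrt_sq_eq_abs, ← Real.sqrt_mul (sq_nonneg _)]
    exact Real.sqrt_le_sqrt hQ'
  have hle : |c * u + d * w| ≤ c * (|rhoM P| * √s) + d * (|rhoM Q| * √t) := by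
    refine (abs_add_le _ _).trans ?_
    rw [abs_mul, abs_mul, abs_of_nonneg hc, abs_of_nonneg hd]
    gcongr
  calc (c * u + d * w) ^ 2 = |c * u + d * w| ^ 2 := (sq_abs _).symm
    _ ≤ (c * (|rhoM P| * √s) + d * (|rhoM Q| * √t)) ^ 2 := by gcongr
    _ ≤ (c * |rhoM P| ^ 2 + d * |rhoM Q| ^ 2) * (c * √s ^ 2 + d * √t ^ 2) := by
      nlinarith [mul_nonneg (mul_nonneg hc hd) (sq_nonneg (|rhoM P| * √t - |rhoM Q| * √s))]
    _ = c * rhoM P ^ 2 + d * rhoM Q ^ 2 := by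
      rw [Real.sq_sqrt hs0, Real.sq_sqrt ht0, sq_abs, sq_abs, hg', mul_one]

end Mixture

section Channels

/-- Use of the channel `q` with weight `c` and of `q'` with weight `d`, revealing which one. -/
def mixChannel {m n : ℕ} (c d : ℝ) (q : β → Fin m → ℝ) (q' : β → Fin n → ℝ) :
    β → Fin (m + n) → ℝ := fun y => Fin.append (fun i => c * q y i) (fun i => d * q' y i)

variable {m n : ℕ} {c d : ℝ} {q : β → Fin m → ℝ} {q' : β → Fin n → ℝ}

lemma IsChannel.mixChannel (hq : IsChannel q) (hq' : IsChannel q') (hc : 0 ≤ c) (hd : 0 ≤ d)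
    (hcd : c + d = 1) : IsChannel (mixChannel c d q q') := by
  refine ⟨fun y z => ?_, fun y => ?_⟩
  · refine Fin.addCases (fun i => ?_) (fun i => ?_) z
    · simpa [RatePrivacy.mixChannel] using mul_nonneg hc (hq.1 y i)
    · simpa [RatePrivacy.mixChannel] using mul_nonneg hd (hq'.1 y i)
  · simp [RatePrivacy.mixChannel, Fin.sum_univ_add, ← Finset.mul_sum, hq.2, hq'.2, hcd]

variable [Fintype α] [Fintype β] [Fintype γ]

lemma IsPMF.jointXZ {p : α × β → ℝ} (hp : IsPMF p) {q : β → γ → ℝ} (hq : IsChannel q) :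
    IsPMF (jointXZ p q) := by
  refine ⟨fun x => Finset.sum_nonneg fun y _ => mul_nonneg (hp.1 _) (hq.1 _ _), ?_⟩
  rw [← hp.2, Fintype.sum_prod_type, Fintype.sum_prod_type]
  refine Finset.sum_congr rfl fun a _ => ?_
  simp only [RatePrivacy.jointXZ]
  rw [Finset.sum_comm]
  simp [← Finset.mul_sum, hq.2]

lemma margA_jointXZ (p : α × β → ℝ) {q : β → γ → ℝ} (hq : IsChannel q) :
    margA (jointXZ p q) = margA p := by
  ext a
  simp only [margA, jointXZ]
  rw [Finset.sum_comm]
  simp [← Finset.mul_sum, hq.2]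

lemma margA_jointYZ (p : α × β → ℝ) {q : β → γ → ℝ} (hq : IsChannel q) :
    margA (jointYZ p q) = margB p := by
  ext b
  simp [margA, jointYZ, ← Finset.mul_sum, hq.2]

lemma IsPMF.jointYZ {p : α × β → ℝ} (hp : IsPMF p) {q : β → γ → ℝ} (hq : IsChannel q) :
    IsPMF (jointYZ p q) := by
  refine ⟨fun x => mul_nonneg (hp.margB.1 _) (hq.1 _ _), ?_⟩
  have h := sum_margA_mul (RatePrivacy.jointYZ p q) 1
  rw [margA_jointYZ p hq] at h
  simpa [hp.margB.2] using h.symm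

lemma bddAbove_ghSet {p : α × β → ℝ} (hp : IsPMF p) (ε : ℝ) : BddAbove (ghSet p ε) := by
  refine ⟨ent (margB p), ?_⟩
  rintro r ⟨n, q, hq, -, rfl⟩
  exact margA_jointYZ p hq ▸ mi_le_ent_margA (hp.jointYZ hq)

lemma ghSet_nonempty {p : α × β → ℝ} (hp : IsPMF p) {ε : ℝ} (hε : 0 ≤ ε) :
    (ghSet p ε).Nonempty := by
  have hq : IsChannel (fun (_ : β) (_ : Fin 1) => (1 : ℝ)) := by simp [IsChannel]
  refine ⟨_, 1, _, hq, rhoM_sq_le hε ?_, rfl⟩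
  rintro r ⟨f, g, -, h0, -, h1, -⟩
  have hB := (hp.jointXZ hq).margB.2
  rw [Fin.sum_univ_one] at h0 h1 hB
  rw [hB, one_mul] at h0 h1
  simp [h0] at h1

lemma jointXZ_mixChannel (p : α × β → ℝ) :
    jointXZ p (mixChannel c d q q') = mix c d (jointXZ p q) (jointXZ p q') := by
  ext ⟨a, z⟩
  refine Fin.addCases (fun i => ?_) (fun i => ?_) z <;>
  simp [jointXZ, mixChannel, Finset.mul_sum, mul_left_comm]

lemma jointYZ_mixChannel (p : α × β → ℝ) :
    jointYZ p (mixChannel c d q q') = mix c d (jointYZ p q) (jointYZ p q') := by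
  ext ⟨b, z⟩
  refine Fin.addCases (fun i => ?_) (fun i => ?_) z <;>
  simp [jointYZ, mixChannel, mul_left_comm]

lemma mix_mem_ghSet {p : α × β → ℝ} (hp : IsPMF p) {ε ε' r r' : ℝ} (hr : r ∈ ghSet p ε)
    (hr' : r' ∈ ghSet p ε') (hc : 0 < c) (hd : 0 < d) (hcd : c + d = 1) :
    c * r + d * r' ∈ ghSet p (c * ε + d * ε') := by
  obtain ⟨m, q, hq, hρ, rfl⟩ := hr
  obtain ⟨n, q', hq', hρ', rfl⟩ := hr'
  refine ⟨m + n, mixChannel c d q q', hq.mixChannel hq' hc.le hd.le hcd, ?_, ?_⟩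
  · rw [jointXZ_mixChannel]
    refine (rhoM_mix_sq_le (hp.jointXZ hq) (hp.jointXZ hq') hc.le hd.le hcd ?_).trans ?_
    · rw [margA_jointXZ p hq, margA_jointXZ p hq']
    · gcongr
  · rw [jointYZ_mixChannel, mi_mix (hp.jointYZ hq) (hp.jointYZ hq') hc.ne' hd.ne' hcd]
    rw [margA_jointYZ p hq, margA_jointYZ p hq']

lemma gh_concave {p : α × β → ℝ} (hp : IsPMF p) {ε ε' : ℝ} (hε : 0 ≤ ε) (hε' : 0 ≤ ε')
    (hc : 0 < c) (hd : 0 < d) (hcd : c + d = 1) :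
    c * gh p ε + d * gh p ε' ≤ gh p (c * ε + d * ε') := by
  have key : ∀ r ∈ ghSet p ε, ∀ r' ∈ ghSet p ε', c * r + d * r' ≤ gh p (c * ε + d * ε') :=
    fun r hr r' hr' => le_csSup (bddAbove_ghSet hp _) (mix_mem_ghSet hp hr hr' hc hd hcd)
  have h1 : ∀ r' ∈ ghSet p ε', gh p ε ≤ (gh p (c * ε + d * ε') - d * r') / c := fun r' hr' =>
    csSup_le (ghSet_nonempty hp hε) fun r hr => by
      rw [le_div_iff₀ hc]
      linarith [key r hr r' hr']
  have h2 : gh p ε' ≤ (gh p (c * ε + d * ε') - c * gh p ε) / d :=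
    csSup_le (ghSet_nonempty hp hε') fun r' hr' => by
      have := h1 r' hr'
      rw [le_div_iff₀ hc] at this
      rw [le_div_iff₀ hd]
      linarith
  rw [le_div_iff₀ hd] at h2
  linarith

end Channels

/-- The map `ε ↦ ĝ_ε(X;Y)` is concave on `[0,∞)`: for all
`0 ≤ ε₁ < ε₂ < ε₃`,
`ĝ_{ε₂} ≥ ((ε₂−ε₁)/(ε₃−ε₁))·ĝ_{ε₃} + ((ε₃−ε₂)/(ε₃−ε₁))·ĝ_{ε₁}`. -/
theorem stmt5 {𝓧 𝓨 : Type*} [Fintype 𝓧] [Fintype 𝓨]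
    (p : 𝓧 × 𝓨 → ℝ) (hp : IsPMF p) :
    ∀ ε₁ ε₂ ε₃ : ℝ, 0 ≤ ε₁ → ε₁ < ε₂ → ε₂ < ε₃ →
      ((ε₂ - ε₁) / (ε₃ - ε₁)) * gh p ε₃ + ((ε₃ - ε₂) / (ε₃ - ε₁)) * gh p ε₁ ≤ gh p ε₂ := by
  intro ε₁ ε₂ ε₃ h₁ h₁₂ h₂₃
  have h₁₃ : 0 < ε₃ - ε₁ := by linarith
  have hconv : ((ε₂ - ε₁) / (ε₃ - ε₁)) * ε₃ + ((ε₃ - ε₂) / (ε₃ - ε₁)) * ε₁ = ε₂ := by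
    field_simp
    ring
  have h := gh_concave hp (h₁.trans (h₁₂.trans h₂₃).le) h₁
    (div_pos (sub_pos.mpr h₁₂) h₁₃) (div_pos (sub_pos.mpr h₂₃) h₁₃) (by field_simp; ring)
  rwa [hconv] at h

end RatePrivacy
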